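/- If 𝔡 is a delta operator on K[x] (a shift-invariant linear operator with 𝔡(x) a nonzero constant), then for every nonconstant polynomial f, deg(𝔡(f)) = deg(f) − 1, and 𝔡(c) = 0 for every constant c. -/

import Mathlib

open Polynomial

/-- The shift operator `E_a : K[x] → K[x]`, `f(x) ↦ f(x+a)`, as a linear endomorphism. -/
noncomputable def shiftOp (K : Type*) [Field K] (a : K) : Module.End K (Polynomial K) :=
  (aeval (X + C a) : Polynomial K →ₐ[K] Polynomial K).toLinearMap

/-- A linear operator on `K[x]` is shift-invariant if it commutes with every shift `E_a`. -/
def IsShiftInvariant {K : Type*} [Field K] (s : Module.End K (Polynomial K)) : Prop :=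
  ∀ a : K, s ∘ₗ shiftOp K a = shiftOp K a ∘ₗ s

/-- A delta operator: shift-invariant and sends `X` to a nonzero constant. -/
def IsDeltaOperator {K : Type*} [Field K] (d : Module.End K (Polynomial K)) : Prop :=
  IsShiftInvariant d ∧ ∃ c : K, c ≠ 0 ∧ d X = C c

/-- The sequence of basic polynomials of a delta operator `d`. -/
def IsBasicSequence {K : Type*} [Field K] (d : Module.End K (Polynomial K))
    (p : ℕ → Polynomial K) : Prop :=
  p 0 = 1 ∧ (∀ n, 1 ≤ n → (p n).eval 0 = 0) ∧
    ∀ n, 1 ≤ n → d (p n) = (n : K) • p (n - 1)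

/-- The generalized Gončarov basis associated with the pair `(d, z)`:
`deg t_n = n` and `ε_{z_i}(d^i t_n) = n! δ_{i,n}`. -/
def IsGoncarovBasis {K : Type*} [Field K] (d : Module.End K (Polynomial K))
    (z : ℕ → K) (t : ℕ → Polynomial K) : Prop :=
  ∀ n, (t n).natDegree = n ∧
    ∀ i, ((d ^ i) (t n)).eval (z i) = if i = n then (n.factorial : K) else 0

theorem shiftOp_eq_taylor {K : Type*} [Field K] (a : K) (f : Polynomial K) :
    shiftOp K a f = taylor a f := by
  simp [shiftOp, taylor_apply, comp, aeval_def, algebraMap_eq]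

theorem IsShiftInvariant.apply_taylor {K : Type*} [Field K] {s : Module.End K (Polynomial K)}
    (hs : IsShiftInvariant s) (a : K) (f : Polynomial K) : s (taylor a f) = taylor a (s f) := by
  simpa [shiftOp_eq_taylor] using LinearMap.congr_fun (hs a) f

theorem IsDeltaOperator.apply_C {K : Type*} [Field K] {d : Module.End K (Polynomial K)}
    (hd : IsDeltaOperator d) (b : K) : d (C b) = 0 := by
  obtain ⟨hs, c, -, hc⟩ := hd
  have h := hs.apply_taylor b X
  rwa [taylor_X, map_add, hc, taylor_C, add_eq_left] at h

/-- The forward difference of a nonconstant polynomial in characteristic zero is nonzero and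
has degree one less. -/
theorem Polynomial.natDegree_taylor_one_sub_self {K : Type*} [Field K] [CharZero K]
    {f : Polynomial K} (hf : 0 < f.natDegree) :
    taylor 1 f - f ≠ 0 ∧ (taylor 1 f - f).natDegree = f.natDegree - 1 := by
  obtain ⟨n, hn⟩ : ∃ n, f.natDegree = n + 1 := ⟨f.natDegree - 1, by omega⟩
  have hf0 : f ≠ 0 := by rintro rfl; simp at hf
  have hcoeff : (taylor 1 f - f).coeff n ≠ 0 := by
    have hle : (hasseDeriv n f).natDegree < 2 := by
      have := natDegree_hasseDeriv_le f n
      omega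
    have hlead : f.coeff (n + 1) ≠ 0 := by
      rw [← hn]
      exact leadingCoeff_ne_zero.mpr hf0
    have hcast : (n + 1 : K) ≠ 0 := Nat.cast_add_one_ne_zero n
    rw [coeff_sub, taylor_coeff, eval_eq_sum_range' hle]
    simp only [Finset.sum_range_succ, Finset.sum_range_zero, hasseDeriv_coeff, one_pow, mul_one,
      zero_add, Nat.choose_self, Nat.cast_one, one_mul, add_comm 1 n, Nat.choose_succ_self_right]
    simpa using ⟨hcast, hlead⟩
  have hlt : (taylor 1 f - f).degree < f.degree := by
    rw [← degree_taylor f 1]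
    exact degree_sub_lt_left (degree_taylor f 1) (by simpa using hf0) (leadingCoeff_taylor 1 f)
  have hne : taylor 1 f - f ≠ 0 := fun h => hcoeff (by rw [h, coeff_zero])
  have hlt' := natDegree_lt_natDegree hne hlt
  have hge := le_natDegree_of_ne_zero hcoeff
  exact ⟨hne, by omega⟩

theorem IsDeltaOperator.natDegree_apply {K : Type*} [Field K] [CharZero K]
    {d : Module.End K (Polynomial K)} (hd : IsDeltaOperator d) (n : ℕ) (f : Polynomial K)
    (hf : f.natDegree = n + 1) : d f ≠ 0 ∧ (d f).natDegree = n := by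
  induction n generalizing f with
  | zero =>
    obtain ⟨a, ha, b, rfl⟩ := natDegree_eq_one.mp hf
    obtain ⟨c, hc0, hc⟩ := hd.2
    have h : d (C a * X + C b) = C (a * c) := by
      rw [map_add, hd.apply_C, add_zero, ← smul_eq_C_mul, map_smul, hc, smul_C, smul_eq_mul]
    rw [h]
    exact ⟨C_ne_zero.mpr (mul_ne_zero ha hc0), natDegree_C _⟩
  | succ n ih =>
    obtain ⟨-, hdeg⟩ := natDegree_taylor_one_sub_self (f := f) (by omega)
    obtain ⟨hne, hdeg'⟩ := ih (taylor 1 f - f) (by omega)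
    rw [map_sub, hd.1.apply_taylor] at hne hdeg'
    have hpos : 0 < (d f).natDegree := by
      by_contra! h
      rw [eq_C_of_natDegree_le_zero h, taylor_C, sub_self] at hne
      exact hne rfl
    have := (natDegree_taylor_one_sub_self hpos).2
    exact ⟨fun h => by simp [h] at hpos, by omega⟩

theorem stmt0 {K : Type*} [Field K] [CharZero K] (d : Module.End K (Polynomial K))
    (hd : IsDeltaOperator d) :
    (∀ f : Polynomial K, 0 < f.natDegree →
        d f ≠ 0 ∧ (d f).natDegree = f.natDegree - 1) ∧
    (∀ c : K, d (C c) = 0) := by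
  refine ⟨fun f hf => ?_, hd.apply_C⟩
  exact hd.natDegree_apply (f.natDegree - 1) f (by omega)
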